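/- arXiv:2111.12536 — 10 statements merged into one kernel-verified Lean document; each statement's English description precedes it below -/
import Mathlib

section
/- Let F be a set of positive semidefinite n×n complex matrices and let X be a positive semidefinite n×n complex matrix. Then the projective robustness Ω_F(X) is finite if and only if there exists K ∈ F whose range (column space, i.e. the range of the associated linear map ℂⁿ → ℂⁿ) equals the range of X. (Theorem 1(i).) -/
open Matrix ComplexOrder

/-- The projective robustness of a PSD matrix `X` relative to a set `F` of PSD matrices:
`Ω_F(X) = inf {λ·μ : λ, μ ∈ [0,∞), ∃ K ∈ F, X ≤ λ • K ∧ K ≤ μ • X}`, with `inf ∅ = ∞`.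
Here `X ≤ Y` means `Y - X` is positive semidefinite. -/
noncomputable def Omega {ι : Type*} [Fintype ι]
    (F : Set (Matrix ι ι ℂ)) (X : Matrix ι ι ℂ) : ENNReal :=
  sInf {γ : ENNReal | ∃ lam mu : ℝ, 0 ≤ lam ∧ 0 ≤ mu ∧
    (∃ K ∈ F, (lam • K - X).PosSemidef ∧ (mu • X - K).PosSemidef) ∧
    γ = ENNReal.ofReal (lam * mu)}

lemma aux_factor {n : ℕ} (S R : Matrix (Fin n) (Fin n) ℂ)
    (h : ∀ v, S *ᵥ v = 0 → R *ᵥ v = 0) : ∃ D : Matrix (Fin n) (Fin n) ℂ, R = D * S := by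
  obtain ⟨g, hg⟩ := LinearMap.exists_rightInverse_of_surjective
    (Matrix.toLin' S).rangeRestrict (LinearMap.range_rangeRestrict _)
  obtain ⟨g', hg'⟩ := LinearMap.exists_extend g
  refine ⟨R * LinearMap.toMatrix' g', ?_⟩
  apply Matrix.toLin'.injective
  refine LinearMap.ext fun v => ?_
  have h1 : S *ᵥ (g' (S *ᵥ v)) = S *ᵥ v := by
    have e1 := LinearMap.congr_fun hg' ((Matrix.toLin' S).rangeRestrict v)
    have e2 := LinearMap.congr_fun hg ((Matrix.toLin' S).rangeRestrict v)
    rw [LinearMap.comp_apply, ← e1] at e2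
    have e4 := congrArg Subtype.val e2
    simpa using e4
  have h2 := h (v - g' (S *ᵥ v)) (by rw [Matrix.mulVec_sub, h1, sub_self])
  rw [Matrix.mulVec_sub, sub_eq_zero] at h2
  simp only [Matrix.toLin'_mul, LinearMap.comp_apply, Matrix.toLin'_toMatrix', Matrix.toLin'_apply]
  exact h2

open scoped MatrixOrder Matrix.Norms.L2Operator in
lemma aux_sqrt {n : ℕ} {A : Matrix (Fin n) (Fin n) ℂ} (hA : A.PosSemidef) :
    ∃ S : Matrix (Fin n) (Fin n) ℂ, A = Sᴴ * S :=
  CStarAlgebra.nonneg_iff_eq_star_mul_self.mp hA.nonneg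

open scoped MatrixOrder Matrix.Norms.L2Operator in
lemma aux_bound {n : ℕ} {A : Matrix (Fin n) (Fin n) ℂ} (hA : A.IsHermitian) :
    ∃ c : ℝ, 0 ≤ c ∧ (c • (1 : Matrix (Fin n) (Fin n) ℂ) - A).PosSemidef := by
  refine ⟨‖A‖, norm_nonneg _, ?_⟩
  have h : A ≤ algebraMap ℝ _ ‖A‖ := IsSelfAdjoint.le_algebraMap_norm_self hA
  rw [Algebra.algebraMap_eq_smul_one] at h
  exact Matrix.le_iff.mp h

lemma aux_le {n : ℕ} {A B : Matrix (Fin n) (Fin n) ℂ} (hA : A.PosSemidef) (hB : B.PosSemidef)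
    {c : ℝ} (h : (c • A - B).PosSemidef) :
    LinearMap.range (Matrix.toLin' B) ≤ LinearMap.range (Matrix.toLin' A) := by
  have hker : ∀ v, A *ᵥ v = 0 → B *ᵥ v = 0 := by
    intro v hv
    rw [← hB.dotProduct_mulVec_zero_iff]
    refine le_antisymm ?_ (hB.dotProduct_mulVec_nonneg v)
    have := h.dotProduct_mulVec_nonneg v
    simpa [Matrix.sub_mulVec, Matrix.smul_mulVec, hv] using this
  obtain ⟨D, hD⟩ := aux_factor A B hker
  have hD' : B = A * Dᴴ := by
    have := congrArg Matrix.conjTranspose hD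
    rwa [Matrix.conjTranspose_mul, hA.1.eq, hB.1.eq] at this
  rw [hD', Matrix.toLin'_mul]
  exact LinearMap.range_comp_le_range _ _

lemma aux_ge {n : ℕ} {A B : Matrix (Fin n) (Fin n) ℂ} (hA : A.PosSemidef) (hB : B.PosSemidef)
    (h : LinearMap.range (Matrix.toLin' B) ≤ LinearMap.range (Matrix.toLin' A)) :
    ∃ c : ℝ, 0 ≤ c ∧ (c • A - B).PosSemidef := by
  have hker : ∀ v, A *ᵥ v = 0 → B *ᵥ v = 0 := by
    intro v hv
    rw [← hB.dotProduct_mulVec_zero_iff]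
    obtain ⟨w, hw⟩ := h ⟨v, rfl⟩
    simp only [Matrix.toLin'_apply] at hw
    rw [← hw, Matrix.dotProduct_mulVec, ← hA.1.eq, Matrix.vecMul_conjTranspose, star_star, hv]
    simp
  obtain ⟨S, rfl⟩ := aux_sqrt hA
  obtain ⟨R, rfl⟩ := aux_sqrt hB
  simp only [Matrix.conjTranspose_mul_self_mulVec_eq_zero] at hker
  obtain ⟨D, rfl⟩ := aux_factor S R hker
  obtain ⟨c, hc, hp⟩ := aux_bound (Matrix.isHermitian_conjTranspose_mul_self D)
  refine ⟨c, hc, ?_⟩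
  have := hp.conjTranspose_mul_mul_same S
  convert this using 1
  simp [Matrix.mul_sub, Matrix.sub_mul, Matrix.mul_assoc]

/-- Theorem 1(i): `Ω_F(X)` is finite iff some `K ∈ F` has the same range as `X`. -/
theorem projective_robustness_finite_iff_range_eq
    (n : ℕ) (F : Set (Matrix (Fin n) (Fin n) ℂ))
    (hF : ∀ K ∈ F, K.PosSemidef)
    (X : Matrix (Fin n) (Fin n) ℂ) (hX : X.PosSemidef) :
    Omega F X ≠ ⊤ ↔
      ∃ K ∈ F, LinearMap.range (Matrix.toLin' K) = LinearMap.range (Matrix.toLin' X) := by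
  constructor
  · intro h
    rw [Omega, ne_eq, sInf_eq_top] at h
    push Not at h
    obtain ⟨γ, ⟨lam, mu, hl, hm, ⟨K, hK, h1, h2⟩, -⟩, -⟩ := h
    exact ⟨K, hK, le_antisymm (aux_le hX (hF K hK) h2) (aux_le (hF K hK) hX h1)⟩
  · rintro ⟨K, hK, he⟩
    obtain ⟨lam, hl, h1⟩ := aux_ge (hF K hK) hX he.ge
    obtain ⟨mu, hm, h2⟩ := aux_ge hX (hF K hK) he.le
    exact ne_top_of_le_ne_top ENNReal.ofReal_ne_top
      (sInf_le ⟨lam, mu, hl, hm, ⟨K, hK, h1, h2⟩, rfl⟩)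
end

section
/- Let F be a convex set of positive semidefinite n×n complex matrices. Then Ω_F is quasiconvex on PSD matrices: for all positive semidefinite n×n matrices X and Y and every t ∈ [0,1], Ω_F(t • X + (1−t) • Y) ≤ max (Ω_F(X), Ω_F(Y)). (Theorem 1(iii).) -/
open Matrix ComplexOrder

/-- Theorem 1(iii): quasiconvexity of the projective robustness when  is convex. -/
theorem projective_robustness_quasiconvex
    (n : ℕ) (F : Set (Matrix (Fin n) (Fin n) ℂ))
    (hF : ∀ K ∈ F, K.PosSemidef) (hconv : Convex ℝ F)
    (X Y : Matrix (Fin n) (Fin n) ℂ) (hX : X.PosSemidef) (hY : Y.PosSemidef)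
    (t : ℝ) (ht : t ∈ Set.Icc (0 : ℝ) 1) :
    Omega F (t • X + (1 - t) • Y) ≤ max (Omega F X) (Omega F Y) := by
  obtain ⟨ht0, ht1⟩ := ht
  have ht1' : 0 ≤ 1 - t := by linarith
  refine le_of_forall_gt fun c hc => ?_
  obtain ⟨h1, h2⟩ := max_lt_iff.mp hc
  obtain ⟨_, ⟨l1, m1, hl1, hm1, ⟨K1, hK1, hA1, hB1⟩, rfl⟩, hc1⟩ := sInf_lt_iff.mp h1
  obtain ⟨_, ⟨l2, m2, hl2, hm2, ⟨K2, hK2, hA2, hB2⟩, rfl⟩, hc2⟩ := sInf_lt_iff.mp h2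
  have ha : 0 ≤ t * l1 := mul_nonneg ht0 hl1
  have hb : 0 ≤ (1 - t) * l2 := mul_nonneg ht1' hl2
  have hA := (hA1.smul ht0).add (hA2.smul ht1')
  rcases (add_nonneg ha hb).eq_or_lt with hs | hs
  · have ha0 : t * l1 = 0 := by linarith
    have hb0 : (1 - t) * l2 = 0 := by linarith
    refine sInf_lt_iff.mpr ⟨_, ⟨0, m1 + m2, le_rfl, add_nonneg hm1 hm2,
      ⟨t • K1 + (1 - t) • K2, hconv hK1 hK2 ht0 ht1' (by ring), ?_, ?_⟩, rfl⟩, ?_⟩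
    · convert hA using 1
      simp only [smul_sub, smul_smul, ha0, hb0]
      module
    · convert ((hB1.smul ht0).add (hB2.smul ht1')).add
        ((hX.smul (mul_nonneg ht0 hm2)).add (hY.smul (mul_nonneg ht1' hm1))) using 1
      module
    · simpa using lt_of_le_of_lt zero_le hc1
  · set s := t * l1 + (1 - t) * l2 with hsdef
    set g := max (l1 * m1) (l2 * m2) with hg
    have hg1 : 0 ≤ g - l1 * m1 := sub_nonneg.mpr (le_max_left _ _)
    have hg2 : 0 ≤ g - l2 * m2 := sub_nonneg.mpr (le_max_right _ _)
    have hg0 : 0 ≤ g := (mul_nonneg hl1 hm1).trans (le_max_left _ _)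
    have hs' : s ≠ 0 := hs.ne'
    refine sInf_lt_iff.mpr ⟨_, ⟨s, s⁻¹ * g, hs.le, by positivity,
      ⟨(s⁻¹ * (t * l1)) • K1 + (s⁻¹ * ((1 - t) * l2)) • K2,
        hconv hK1 hK2 (by positivity) (by positivity) ?_, ?_, ?_⟩, rfl⟩, ?_⟩
    · rw [← mul_add, ← hsdef, inv_mul_cancel₀ hs']
    · convert hA using 1
      simp only [smul_add, smul_sub, smul_smul, mul_inv_cancel_left₀ hs']
      module
    · have hi : 0 ≤ s⁻¹ := by positivity
      convert (((hB1.smul ha).add (hB2.smul hb)).add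
        ((hX.smul (mul_nonneg ht0 hg1)).add (hY.smul (mul_nonneg ht1' hg2)))).smul hi using 1
      clear_value s g
      module
    · rw [mul_inv_cancel_left₀ hs']
      rcases max_choice (l1 * m1) (l2 * m2) with h | h <;> rw [hg, h] <;> assumption
end

section
/- Let F be a set of positive semidefinite n×n complex matrices and G a set of positive semidefinite m×m complex matrices. Let Θ be an ℝ-linear map from n×n complex matrices to m×m complex matrices such that Θ maps every PSD matrix to a PSD matrix and Θ(K) ∈ G for every K ∈ F. Then for every positive semidefinite n×n matrix X, Ω_G(Θ(X)) ≤ Ω_F(X). (Theorem 1(iv): monotonicity of the projective robustness of channels under free superchannels, expressed on Choi matrices.) -/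
open Matrix ComplexOrder

/-- Theorem 1(iv): monotonicity of the projective robustness under free superchannels,
expressed on Choi matrices: Θ is ℝ-linear, positivity-preserving and maps F into G. -/
theorem projective_robustness_monotone
    (n m : ℕ) (F : Set (Matrix (Fin n) (Fin n) ℂ)) (G : Set (Matrix (Fin m) (Fin m) ℂ))
    (hF : ∀ K ∈ F, K.PosSemidef) (hG : ∀ K ∈ G, K.PosSemidef)
    (Θ : Matrix (Fin n) (Fin n) ℂ →ₗ[ℝ] Matrix (Fin m) (Fin m) ℂ)
    (hpos : ∀ Y : Matrix (Fin n) (Fin n) ℂ, Y.PosSemidef → (Θ Y).PosSemidef)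
    (hfree : ∀ K ∈ F, Θ K ∈ G)
    (X : Matrix (Fin n) (Fin n) ℂ) (hX : X.PosSemidef) :
    Omega G (Θ X) ≤ Omega F X := by
  unfold Omega
  apply sInf_le_sInf
  rintro γ ⟨lam, mu, hl, hm, ⟨K, hK, h1, h2⟩, rfl⟩
  refine ⟨lam, mu, hl, hm, ⟨Θ K, hfree K hK, ?_, ?_⟩, rfl⟩
  · have h := hpos _ h1
    rwa [map_sub, map_smul] at h
  · have h := hpos _ h2
    rwa [map_sub, map_smul] at h
end

section
/- Fix d ≥ 1 and let 𝔽 be a nonempty compact convex set of density matrices on ℂ^d. Let F be a set of channel Choi matrices, i.e. PSD matrices J indexed by (Fin d × Fin d) satisfying the trace-preservation condition ∑_b J((i,b),(j,b)) = δ_{ij}, such that F is resource non-generating: for every K ∈ F and every τ ∈ 𝔽, the output state K[τ] (the d×d matrix with entries K[τ]_{b,b'} = ∑_{i,j} τ_{i,j} · K((i,b),(j,b'))) belongs to 𝔽. Then: (a) for every density matrix ω on ℂ^d, Ω_F(I_d ⊗ ω) ≥ Ω_𝔽(ω), where I_d ⊗ ω denotes the Kronecker product of the d×d identity with ω (the Choi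 matrix of the replacement channel ρ ↦ Tr(ρ)ω); (b) if, in addition, I_d ⊗ σ ∈ F for every σ ∈ 𝔽, then Ω_F(I_d ⊗ ω) = Ω_𝔽(ω). (Proposition 1.) -/
open Matrix ComplexOrder Kronecker

/-- The output state of the channel with Choi matrix `K` (indexed by input ⊗ output)
on an input state `τ`. -/
noncomputable def chOut {d : ℕ} (K : Matrix (Fin d × Fin d) (Fin d × Fin d) ℂ)
    (τ : Matrix (Fin d) (Fin d) ℂ) : Matrix (Fin d) (Fin d) ℂ :=
  fun b b' => ∑ i, ∑ j, τ i j * K (i, b) (j, b')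

lemma chOut_psd {d : ℕ} {K : Matrix (Fin d × Fin d) (Fin d × Fin d) ℂ}
    {τ : Matrix (Fin d) (Fin d) ℂ} (hK : K.PosSemidef) (hτ : τ.PosSemidef) :
    (chOut K τ).PosSemidef := by
  obtain ⟨B, rfl⟩ : ∃ B : Matrix (Fin d) (Fin d) ℂ, τ = Bᴴ * B := by
    open scoped MatrixOrder in
    obtain ⟨B, hB⟩ := CStarAlgebra.nonneg_iff_eq_star_mul_self.mp hτ.nonneg
    exact ⟨B, hB⟩
  let M : Fin d → Matrix (Fin d × Fin d) (Fin d) ℂ :=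
    fun k => Matrix.of fun p b => if p.2 = b then B k p.1 else 0
  have hM : ∀ k i c b, M k (i, c) b = if c = b then B k i else 0 := fun _ _ _ _ => rfl
  have h : chOut K (Bᴴ * B) = ∑ k, (M k)ᴴ * K * M k := by
    ext b b'
    simp only [chOut, hM, Matrix.sum_apply, Matrix.mul_apply, Matrix.conjTranspose_apply,
      Fintype.sum_prod_type, Finset.sum_mul, apply_ite star, star_zero, ite_mul, zero_mul,
      mul_ite, mul_zero, Finset.sum_ite_eq', Finset.mem_univ, if_true]
    symm
    rw [Finset.sum_comm, Finset.sum_comm]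
    rw [Finset.sum_congr rfl fun k _ => Finset.sum_comm, Finset.sum_comm]
    refine Finset.sum_congr rfl fun i _ => ?_
    rw [Finset.sum_comm]
    refine Finset.sum_congr rfl fun j _ => Finset.sum_congr rfl fun k _ => ?_
    ring
  rw [h]
  exact Matrix.posSemidef_sum _ fun k _ => hK.conjTranspose_mul_mul_same _

lemma chOut_sub {d : ℕ} (a b : ℝ) (K L : Matrix (Fin d × Fin d) (Fin d × Fin d) ℂ)
    (τ : Matrix (Fin d) (Fin d) ℂ) :
    chOut (a • K - b • L) τ = a • chOut K τ - b • chOut L τ := by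
  ext x y
  simp only [chOut, Matrix.sub_apply, Matrix.smul_apply, Complex.real_smul, Finset.mul_sum,
    ← Finset.sum_sub_distrib]
  refine Finset.sum_congr rfl fun i _ => Finset.sum_congr rfl fun j _ => ?_
  ring

lemma chOut_repl {d : ℕ} (ω τ : Matrix (Fin d) (Fin d) ℂ) (hτ : τ.trace = 1) :
    chOut ((1 : Matrix (Fin d) (Fin d) ℂ) ⊗ₖ ω) τ = ω := by
  ext x y
  simp only [chOut, Matrix.kroneckerMap_apply, Matrix.one_apply, ite_mul, one_mul, zero_mul,
    mul_ite, mul_zero, Finset.sum_ite_eq, Finset.mem_univ, if_true, ← Finset.sum_mul]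
  have : ∑ i, τ i i = 1 := hτ
  rw [this, one_mul]

lemma kron_sub' {d : ℕ} (a b : ℝ) (σ ω : Matrix (Fin d) (Fin d) ℂ) :
    a • ((1 : Matrix (Fin d) (Fin d) ℂ) ⊗ₖ σ) - b • ((1 : Matrix (Fin d) (Fin d) ℂ) ⊗ₖ ω)
      = (1 : Matrix (Fin d) (Fin d) ℂ) ⊗ₖ (a • σ - b • ω) := by
  ext x y
  simp only [Matrix.sub_apply, Matrix.smul_apply, Matrix.kroneckerMap_apply, Complex.real_smul]
  ring

/-- Proposition 1: for any replacement channel (with Choi matrix `1 ⊗ₖ ω`),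
`Ω_F(1 ⊗ₖ ω) ≥ Ω_𝔽(ω)`; with equality if all free replacement channels are free. -/
theorem projective_robustness_replacement_channel
    (d : ℕ) (hd : 1 ≤ d)
    (𝔽 : Set (Matrix (Fin d) (Fin d) ℂ))
    (h𝔽ne : 𝔽.Nonempty) (h𝔽c : IsCompact 𝔽) (h𝔽conv : Convex ℝ 𝔽)
    (h𝔽 : ∀ σ ∈ 𝔽, σ.PosSemidef ∧ σ.trace = 1)
    (F : Set (Matrix (Fin d × Fin d) (Fin d × Fin d) ℂ))
    (hFpsd : ∀ K ∈ F, K.PosSemidef)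
    (hFtp : ∀ K ∈ F, ∀ i j : Fin d,
      (∑ b, K (i, b) (j, b)) = if i = j then 1 else 0)
    (hFrng : ∀ K ∈ F, ∀ τ ∈ 𝔽, chOut K τ ∈ 𝔽) :
    (∀ ω : Matrix (Fin d) (Fin d) ℂ, ω.PosSemidef → ω.trace = 1 →
      Omega 𝔽 ω ≤ Omega F ((1 : Matrix (Fin d) (Fin d) ℂ) ⊗ₖ ω))
    ∧ ((∀ σ ∈ 𝔽, (1 : Matrix (Fin d) (Fin d) ℂ) ⊗ₖ σ ∈ F) →
      ∀ ω : Matrix (Fin d) (Fin d) ℂ, ω.PosSemidef → ω.trace = 1 →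
        Omega F ((1 : Matrix (Fin d) (Fin d) ℂ) ⊗ₖ ω) = Omega 𝔽 ω) := by
  have A : ∀ ω : Matrix (Fin d) (Fin d) ℂ, ω.PosSemidef → ω.trace = 1 →
      Omega 𝔽 ω ≤ Omega F ((1 : Matrix (Fin d) (Fin d) ℂ) ⊗ₖ ω) := by
    intro ω _ _
    obtain ⟨τ, hτ⟩ := h𝔽ne
    refine sInf_le_sInf ?_
    rintro γ ⟨lam, mu, hl, hm, ⟨K, hK, h1, h2⟩, rfl⟩
    refine ⟨lam, mu, hl, hm, ⟨chOut K τ, hFrng K hK τ hτ, ?_, ?_⟩, rfl⟩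
    · have := chOut_psd h1 (h𝔽 τ hτ).1
      have e := chOut_sub lam 1 K ((1 : Matrix (Fin d) (Fin d) ℂ) ⊗ₖ ω) τ
      rw [one_smul, one_smul, chOut_repl _ _ (h𝔽 τ hτ).2] at e
      rwa [e] at this
    · have := chOut_psd h2 (h𝔽 τ hτ).1
      have e := chOut_sub mu 1 ((1 : Matrix (Fin d) (Fin d) ℂ) ⊗ₖ ω) K τ
      rw [one_smul, one_smul, chOut_repl _ _ (h𝔽 τ hτ).2] at e
      rwa [e] at this
  refine ⟨A, fun hR ω hω ht => le_antisymm ?_ (A ω hω ht)⟩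
  refine sInf_le_sInf ?_
  rintro γ ⟨lam, mu, hl, hm, ⟨K, hK, h1, h2⟩, rfl⟩
  refine ⟨lam, mu, hl, hm, ⟨_, hR K hK, ?_, ?_⟩, rfl⟩
  · have e := kron_sub' lam 1 K ω
    rw [one_smul, one_smul] at e
    rw [e]
    exact Matrix.PosSemidef.one.kronecker h1
  · have e := kron_sub' mu 1 ω K
    rw [one_smul, one_smul] at e
    rw [e]
    exact Matrix.PosSemidef.one.kronecker h2
end

section
/- Let P and Q be positive semidefinite d×d complex matrices with Tr P = 1 and Tr Q = 1, and let τ = v v* for a unit vector v ∈ ℂ^d (a pure state). Let ε, f ∈ (0,1) and λ, μ ∈ [0,∞) satisfy: P ≤ λ • Q, Q ≤ μ • P, Tr(τ·P) ≥ 1 − ε, and Tr(τ·Q) ≤ f (these traces are real numbers). Then λ·μ ≥ (1−ε)(1−f)/(ε·f); equivalently, ε ≥ ((f/(1−f))·λμ + 1)⁻¹. (The key estimate in the proof of Theorem 2, giving the lower bound on the error of any deterministic channel resource distillation: here P is the output of the distilled channel on a fixed pure input, τ the corresponding pure output of the target channel, Q the output of an optimal free channel, and λμ witnesses the projective robustness.)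 -/
open Matrix ComplexOrder

lemma proj_trace_nonneg {d : ℕ} (T A : Matrix (Fin d) (Fin d) ℂ) (hA : A.PosSemidef)
    (hT : Tᴴ = T) (hTT : T * T = T) : 0 ≤ ((T * A).trace).re := by
  have h := (hA.mul_mul_conjTranspose_same T).trace_nonneg
  rw [hT, Matrix.trace_mul_comm, ← Matrix.mul_assoc, hTT] at h
  exact (Complex.le_def.mp h).1

/-- The key estimate in the proof of Theorem 2: if `P ≤ λ • Q`, `Q ≤ μ • P`
(where `X ≤ Y` means `Y - X` is PSD), the fidelity of the state `P` with the pure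
state `τ = v v*` is at least `1 - ε`, and the overlap of `Q` with `τ` is at most `f`,
then `λ·μ ≥ (1-ε)(1-f)/(ε·f)`; equivalently `ε ≥ ((f/(1-f))·λμ + 1)⁻¹`. -/
theorem distillation_error_bound
    (d : ℕ) (P Q : Matrix (Fin d) (Fin d) ℂ)
    (hP : P.PosSemidef) (hQ : Q.PosSemidef)
    (hPtr : P.trace = 1) (hQtr : Q.trace = 1)
    (v : Fin d → ℂ) (hv : star v ⬝ᵥ v = 1)
    (τ : Matrix (Fin d) (Fin d) ℂ) (hτ : τ = Matrix.vecMulVec v (star v))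
    (ε f lam mu : ℝ)
    (hε : ε ∈ Set.Ioo (0 : ℝ) 1) (hf : f ∈ Set.Ioo (0 : ℝ) 1)
    (hlam : 0 ≤ lam) (hmu : 0 ≤ mu)
    (h1 : (lam • Q - P).PosSemidef) (h2 : (mu • P - Q).PosSemidef)
    (h3 : 1 - ε ≤ ((τ * P).trace).re) (h4 : ((τ * Q).trace).re ≤ f) :
    (1 - ε) * (1 - f) / (ε * f) ≤ lam * mu
    ∧ ((f / (1 - f)) * (lam * mu) + 1)⁻¹ ≤ ε := by
  obtain ⟨hε0, hε1⟩ := hε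
  obtain ⟨hf0, hf1⟩ := hf
  have hT : τᴴ = τ := by
    rw [hτ, Matrix.conjTranspose_vecMulVec, star_star]
  have hTT : τ * τ = τ := by
    rw [hτ, Matrix.vecMulVec_mul_vecMulVec, hv, one_smul]
  have hS : (1 - τ)ᴴ = 1 - τ := by
    rw [Matrix.conjTranspose_sub, hT, Matrix.conjTranspose_one]
  have hSS : (1 - τ) * (1 - τ) = 1 - τ := by
    rw [sub_mul, mul_sub, mul_sub, hTT]; simp
  have a := proj_trace_nonneg τ _ h1 hT hTT
  have b := proj_trace_nonneg (1 - τ) _ h2 hS hSS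
  simp only [mul_sub, sub_mul, one_mul, Matrix.mul_smul, Matrix.trace_sub, Matrix.trace_smul,
    hPtr, hQtr, Complex.sub_re, Complex.smul_re, Complex.one_re, smul_eq_mul] at a b
  have c1 : 1 - ε ≤ lam * f := by nlinarith
  have c2 : 1 - f ≤ mu * ε := by nlinarith
  have c3 : (1 - ε) * (1 - f) ≤ (lam * f) * (mu * ε) :=
    mul_le_mul c1 c2 (by linarith) (by positivity)
  have hf' : 0 < 1 - f := by linarith
  have hlm : 0 ≤ lam * mu := mul_nonneg hlam hmu
  constructor
  · rw [div_le_iff₀ (by positivity)]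
    linarith
  · have e : 0 < f / (1 - f) * (lam * mu) + 1 := by positivity
    rw [inv_le_iff_one_le_mul₀ e]
    have : ε * (f / (1 - f) * (lam * mu) + 1) = (lam * f) * (mu * ε) / (1 - f) + ε := by
      field_simp
    have h5 : 1 - ε ≤ (lam * f) * (mu * ε) / (1 - f) := by
      rw [le_div_iff₀ hf']; exact c3
    linarith
end

section
/- Fix positive integers d and n, and let ℳF be a convex set of POVMs with n outcomes on ℂ^d (convexity taken componentwise: for POVMs N, N' ∈ ℳF and t ∈ [0,1], the POVM with effects t•N i + (1−t)•N' i is in ℳF). Then Ω_{ℳF} is quasiconvex: for all POVMs M, M' and all t ∈ [0,1], Ω_{ℳF}(t M + (1−t) M') ≤ max (Ω_{ℳF}(M), Ω_{ℳF}(M')), where t M + (1−t) M' is the POVM with i-th effect t•(M i) + (1−t)•(M' i). (Theorem 6(iii).) -/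
open Matrix ComplexOrder

/-- A POVM with n outcomes on the d-dimensional complex Hilbert space. -/
def IsPOVM {d n : ℕ} (M : Fin n → Matrix (Fin d) (Fin d) ℂ) : Prop :=
  (∀ i, (M i).PosSemidef) ∧ (∑ i, M i) = 1

/-- The projective robustness of a tuple of effects relative to a set of free
measurements (inf ∅ = ∞); X ≤ Y means Y - X is PSD. -/
noncomputable def OmegaM {d n : ℕ}
    (MF : Set (Fin n → Matrix (Fin d) (Fin d) ℂ))
    (M : Fin n → Matrix (Fin d) (Fin d) ℂ) : ENNReal :=
  sInf {γ : ENNReal | ∃ lam mu : ℝ, 0 ≤ lam ∧ 0 ≤ mu ∧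
    (∃ N ∈ MF, ∀ i, (lam • N i - M i).PosSemidef ∧ (mu • M i - N i).PosSemidef) ∧
    γ = ENNReal.ofReal (lam * mu)}

/-- Nonnegative real multiples of PSD matrices are PSD. -/
theorem psd_real_smul {d : ℕ} {A : Matrix (Fin d) (Fin d) ℂ} (hA : A.PosSemidef) {a : ℝ}
    (ha : 0 ≤ a) : (a • A).PosSemidef := hA.smul ha

theorem lam_ge_one {d n : ℕ} (hd : 0 < d) {N M : Fin n → Matrix (Fin d) (Fin d) ℂ}
    (hN : IsPOVM N) (hM : IsPOVM M) {lam : ℝ}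
    (h : ∀ i, (lam • N i - M i).PosSemidef) : 1 ≤ lam := by
  have h1 : (∑ i, (lam • N i - M i)).PosSemidef :=
    Matrix.posSemidef_sum _ (fun i _ => h i)
  rw [Finset.sum_sub_distrib, ← Finset.smul_sum, hN.2, hM.2] at h1
  have h2 := h1.diag_nonneg (i := ⟨0, hd⟩)
  have h3 := (Complex.le_def.mp h2).1
  simp at h3
  linarith

theorem omega_combine {d n : ℕ} (hd : 0 < d)
    (MF : Set (Fin n → Matrix (Fin d) (Fin d) ℂ))
    (hMF : ∀ N ∈ MF, IsPOVM N) (hconv : Convex ℝ MF)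
    (M M' : Fin n → Matrix (Fin d) (Fin d) ℂ) (hM : IsPOVM M) (hM' : IsPOVM M')
    (t : ℝ) (ht : t ∈ Set.Icc (0 : ℝ) 1)
    (N N' : Fin n → Matrix (Fin d) (Fin d) ℂ) (hN : N ∈ MF) (hN' : N' ∈ MF)
    (a b a' b' : ℝ) (hb : 0 ≤ b)
    (h : ∀ i, (a • N i - M i).PosSemidef ∧ (b • M i - N i).PosSemidef)
    (h' : ∀ i, (a' • N' i - M' i).PosSemidef ∧ (b' • M' i - N' i).PosSemidef) :
    OmegaM MF (fun i => t • M i + (1 - t) • M' i) ≤ ENNReal.ofReal (max (a * b) (a' * b')) := by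
  have ha := lam_ge_one hd (hMF N hN) hM (fun i => (h i).1)
  have ha' := lam_ge_one hd (hMF N' hN') hM' (fun i => (h' i).1)
  obtain ⟨t0, t1⟩ := ht
  have t1' : 0 ≤ 1 - t := by linarith
  have hs : 0 < t * a + (1 - t) * a' := by nlinarith
  set s := t * a + (1 - t) * a' with hsdef
  set m := max (a * b) (a' * b') with hm
  have hm1 : a * b ≤ m := le_max_left _ _
  have hm2 : a' * b' ≤ m := le_max_right _ _
  have hm0 : 0 ≤ m := le_trans (by positivity) hm1
  apply sInf_le
  refine ⟨s, m / s, hs.le, by positivity,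
    ⟨(t * a / s) • N + ((1 - t) * a' / s) • N', ?_, ?_⟩, ?_⟩
  · apply hconv hN hN'
    · positivity
    · positivity
    · rw [← add_div, ← hsdef, div_self hs.ne']
  · intro i
    constructor
    · have e : s • (((t * a / s) • N + ((1 - t) * a' / s) • N') i) - (t • M i + (1 - t) • M' i)
          = t • (a • N i - M i) + (1 - t) • (a' • N' i - M' i) := by
        simp only [Pi.add_apply, Pi.smul_apply, smul_add, smul_smul, mul_div_cancel₀ _ hs.ne']
        module
      rw [e]
      exact (psd_real_smul (h i).1 t0).add (psd_real_smul (h' i).1 t1')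
    · have e : (m / s) • (t • M i + (1 - t) • M' i) - ((t * a / s) • N + ((1 - t) * a' / s) • N') i
          = (t * a / s) • (b • M i - N i) + ((1 - t) * a' / s) • (b' • M' i - N' i)
            + ((t * (m - a * b) / s) • M i + ((1 - t) * (m - a' * b') / s) • M' i) := by
        simp only [Pi.add_apply, Pi.smul_apply]
        module
      rw [e]
      refine ((psd_real_smul (h i).2 (by positivity)).add
        (psd_real_smul (h' i).2 (by positivity))).add
        ((psd_real_smul (hM.1 i) ?_).add (psd_real_smul (hM'.1 i) ?_))
      · exact div_nonneg (mul_nonneg t0 (by linarith)) hs.le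
      · exact div_nonneg (mul_nonneg t1' (by linarith)) hs.le
  · rw [mul_div_cancel₀ _ hs.ne']

/-- Theorem 6(iii): quasiconvexity of the projective robustness of measurements. -/
theorem projective_robustness_measurement_quasiconvex
    (d n : ℕ) (hd : 0 < d) (hn : 0 < n)
    (MF : Set (Fin n → Matrix (Fin d) (Fin d) ℂ))
    (hMF : ∀ N ∈ MF, IsPOVM N) (hconv : Convex ℝ MF)
    (M M' : Fin n → Matrix (Fin d) (Fin d) ℂ) (hM : IsPOVM M) (hM' : IsPOVM M')
    (t : ℝ) (ht : t ∈ Set.Icc (0 : ℝ) 1) :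
    OmegaM MF (fun i => t • M i + (1 - t) • M' i) ≤
      max (OmegaM MF M) (OmegaM MF M') := by
  by_contra hlt
  rw [not_le, max_lt_iff] at hlt
  obtain ⟨h1, h2⟩ := hlt
  obtain ⟨γ, ⟨a, b, ha, hb, ⟨N, hN, h⟩, rfl⟩, hγ⟩ := sInf_lt_iff.mp h1
  obtain ⟨γ', ⟨a', b', ha', hb', ⟨N', hN', h'⟩, rfl⟩, hγ'⟩ := sInf_lt_iff.mp h2
  have key := omega_combine hd MF hMF hconv M M' hM hM' t ht N N' hN hN' a b a' b' hb h h'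
  rcases max_choice (a * b) (a' * b') with e | e
  · rw [e] at key
    exact absurd hγ (not_lt.mpr key)
  · rw [e] at key
    exact absurd hγ' (not_lt.mpr key)
end

section
/- Fix positive integers d and n, and let ℳF be a set of POVMs with n outcomes on ℂ^d. Let Γ be an ℝ-linear map on n-tuples of d×d complex matrices such that (a) Γ is componentwise positive: if every X i is PSD then every (Γ X) i is PSD, and (b) Γ maps ℳF into ℳF. Then for every POVM M, Ω_{ℳF}(Γ M) ≤ Ω_{ℳF}(M). (Theorem 6(iv): monotonicity of the projective robustness of measurements under free operations.) -/
open Matrix ComplexOrder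

/-- Theorem 6(iv): monotonicity of the projective robustness of measurements under a
free operation, i.e. an ℝ-linear, componentwise-positive map preserving the free set. -/
theorem projective_robustness_measurement_monotone
    (d n : ℕ) (hd : 0 < d) (hn : 0 < n)
    (MF : Set (Fin n → Matrix (Fin d) (Fin d) ℂ)) (hMF : ∀ N ∈ MF, IsPOVM N)
    (Γ : (Fin n → Matrix (Fin d) (Fin d) ℂ) →ₗ[ℝ] (Fin n → Matrix (Fin d) (Fin d) ℂ))
    (hpos : ∀ X : Fin n → Matrix (Fin d) (Fin d) ℂ,
      (∀ i, (X i).PosSemidef) → ∀ i, ((Γ X) i).PosSemidef)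
    (hfree : ∀ N ∈ MF, Γ N ∈ MF)
    (M : Fin n → Matrix (Fin d) (Fin d) ℂ) (hM : IsPOVM M) :
    OmegaM MF (Γ M) ≤ OmegaM MF M := by
  unfold OmegaM
  apply sInf_le_sInf
  rintro γ ⟨lam, mu, hl, hm, ⟨N, hN, h⟩, rfl⟩
  refine ⟨lam, mu, hl, hm, ⟨Γ N, hfree N hN, fun i => ⟨?_, ?_⟩⟩, rfl⟩
  · have h1 := hpos (lam • N - M) (fun j => (h j).1) i
    rw [map_sub, map_smul] at h1
    exact h1
  · have h1 := hpos (mu • M - N) (fun j => (h j).2) i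
    rw [map_sub, map_smul] at h1
    exact h1
end

section
/- Fix positive integers d and n, and let ℳF be a nonempty compact convex set of POVMs with n outcomes on ℂ^d. Then for every POVM M: (a) Ω_{ℳF}(M) = inf {γ ∈ [0,∞) : ∃ c ∈ [0,∞), ∃ N ∈ ℳF, ∀ i, M i ≤ c • (N i) and c • (N i) ≤ γ • (M i)} (primal conic form over the cone generated by ℳF); and (b) strong duality holds: Ω_{ℳF}(M) = sup {∑_i Tr((A i)·(M i)) : A i, B i PSD for all i, ∑_i Tr((B i)·(M i)) = 1, and ∑_i Tr((A i)·(N i)) ≤ ∑_i Tr((B i)·(N i)) for every N ∈ ℳF}, where all traces are real and the equalities are understood in [0,∞]. (Theorem 6(v).) -/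
open Matrix ComplexOrder

lemma aux_trace_nonneg {d : ℕ} {A B : Matrix (Fin d) (Fin d) ℂ} (hA : A.PosSemidef)
    (hB : B.PosSemidef) : 0 ≤ ((A * B).trace).re := by
  obtain ⟨C, rfl⟩ : ∃ C : Matrix (Fin d) (Fin d) ℂ, A = star C * C := by
    open scoped MatrixOrder in
    exact CStarAlgebra.nonneg_iff_eq_star_mul_self.1 hA.nonneg
  have h := (hB.mul_mul_conjTranspose_same C).trace_nonneg
  have e : (star C * C * B).trace = (C * B * Cᴴ).trace := by
    rw [Matrix.trace_mul_comm (C * B), star_eq_conjTranspose, Matrix.mul_assoc]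
  rw [e]
  exact (Complex.le_def.1 h).1

lemma aux_isClosed (d : ℕ) : IsClosed {A : Matrix (Fin d) (Fin d) ℂ | A.PosSemidef} := by
  simp only [Matrix.posSemidef_iff_dotProduct_mulVec, Set.ofPred_and, Set.ofPred_forall]
  refine IsClosed.inter ?_ (isClosed_iInter fun x => ?_)
  · exact isClosed_eq (by fun_prop) (by fun_prop)
  · exact isClosed_le (by fun_prop) (by fun_prop)

lemma aux_repr {d : ℕ} (φ : Matrix (Fin d) (Fin d) ℂ →ₗ[ℝ] ℝ)
    (hφ : ∀ X : Matrix (Fin d) (Fin d) ℂ, X.PosSemidef → 0 ≤ φ X) :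
    ∃ A : Matrix (Fin d) (Fin d) ℂ, A.PosSemidef ∧
      ∀ X : Matrix (Fin d) (Fin d) ℂ, X.IsHermitian → φ X = ((A * X).trace).re := by
  let L : Matrix (Fin d) (Fin d) ℂ := fun k j =>
    (φ (Matrix.single j k 1) : ℂ) - Complex.I * (φ (Matrix.single j k Complex.I) : ℂ)
  have hL : ∀ X, φ X = ((L * X).trace).re := by
    intro X
    conv_lhs => rw [Matrix.matrix_eq_sum_single X]
    simp only [map_sum, Matrix.trace, Matrix.diag_apply, Matrix.mul_apply, Complex.re_sum]
    rw [Finset.sum_comm]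
    refine Finset.sum_congr rfl fun k _ => Finset.sum_congr rfl fun j _ => ?_
    have : Matrix.single j k (X j k) = (X j k).re • Matrix.single j k (1 : ℂ)
        + (X j k).im • Matrix.single j k Complex.I := by
      rw [Matrix.smul_single, Matrix.smul_single, ← Matrix.single_add]
      congr 1
      apply Complex.ext <;> simp
    rw [this, map_add, map_smul, map_smul]
    simp [L]
    ring
  have hLs : ∀ X : Matrix (Fin d) (Fin d) ℂ, X.IsHermitian →
      ((Lᴴ * X).trace).re = ((L * X).trace).re := by
    intro X hX
    have : (Lᴴ * X) = (X * L)ᴴ := by rw [conjTranspose_mul, hX.eq]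
    rw [this, trace_conjTranspose, Matrix.trace_mul_comm]
    simp
  have key : ∀ X : Matrix (Fin d) (Fin d) ℂ, X.IsHermitian →
      φ X = (((((1/2 : ℝ)) • (L + Lᴴ)) * X).trace).re := by
    intro X hX
    rw [Matrix.smul_mul, Matrix.trace_smul, Matrix.add_mul, Matrix.trace_add, Complex.smul_re,
      Complex.add_re, hLs X hX, ← hL X]
    simp
    ring
  have hH : (((1/2 : ℝ)) • (L + Lᴴ)).IsHermitian := by
    unfold Matrix.IsHermitian
    rw [conjTranspose_smul, conjTranspose_add, conjTranspose_conjTranspose, add_comm L]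
    simp
  refine ⟨((1/2 : ℝ)) • (L + Lᴴ), ?_, key⟩
  refine Matrix.PosSemidef.of_dotProduct_mulVec_nonneg hH fun v => ?_
  have hP := Matrix.posSemidef_vecMulVec_self_star v
  have h1 := hφ _ hP
  rw [key _ hP.isHermitian, Matrix.mul_vecMulVec, Matrix.trace_vecMulVec, dotProduct_comm] at h1
  rw [Complex.le_def]
  exact ⟨h1, (hH.im_star_dotProduct_mulVec_self v).symm⟩

lemma aux_repr_pi {d n : ℕ} (φ : (Fin n → Matrix (Fin d) (Fin d) ℂ) →ₗ[ℝ] ℝ)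
    (hφ : ∀ X : Fin n → Matrix (Fin d) (Fin d) ℂ, (∀ i, (X i).PosSemidef) → 0 ≤ φ X) :
    ∃ A : Fin n → Matrix (Fin d) (Fin d) ℂ, (∀ i, (A i).PosSemidef) ∧
      ∀ X : Fin n → Matrix (Fin d) (Fin d) ℂ, (∀ i, (X i).IsHermitian) →
        φ X = ∑ i, ((A i * X i).trace).re := by
  have h := fun i : Fin n => aux_repr
    (φ ∘ₗ LinearMap.single ℝ (fun _ : Fin n => Matrix (Fin d) (Fin d) ℂ) i)
    (fun X hX => hφ (Pi.single i X) (fun j => by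
      by_cases hj : j = i
      · subst hj; simpa using hX
      · rw [Pi.single_eq_of_ne hj]; exact Matrix.PosSemidef.zero))
  choose A hA hA' using h
  refine ⟨A, hA, fun X hX => ?_⟩
  have hs : ∑ i, Pi.single i (X i) = X :=
    LinearMap.sum_single_apply (fun _ : Fin n => Matrix (Fin d) (Fin d) ℂ) X
  conv_lhs => rw [← hs]
  rw [map_sum]
  refine Finset.sum_congr rfl fun i _ => ?_
  simpa using hA' i (X i) (hX i)

lemma aux_cone_convex {E : Type*} [AddCommGroup E] [Module ℝ E] {S : Set E} (hS : Convex ℝ S)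
    (g : ℝ) : Convex ℝ ((fun p : ℝ × E => p.1 • p.2) '' (Set.Icc 0 g ×ˢ S)) := by
  rintro _ ⟨⟨c, N⟩, ⟨⟨hc, hcg⟩, hN⟩, rfl⟩ _ ⟨⟨c', N'⟩, ⟨⟨hc', hcg'⟩, hN'⟩, rfl⟩ a b ha hb hab
  simp only at *
  have h1 : 0 ≤ a * c := mul_nonneg ha hc
  have h2 : 0 ≤ b * c' := mul_nonneg hb hc'
  have hle : a * c + b * c' ≤ g := by nlinarith
  rcases eq_or_lt_of_le (add_nonneg h1 h2) with h0 | h0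
  · have e1 : a * c = 0 := by linarith
    have e2 : b * c' = 0 := by linarith
    exact ⟨(0, N), ⟨⟨le_rfl, hc.trans hcg⟩, hN⟩, by simp [smul_smul, e1, e2]⟩
  · refine ⟨(a * c + b * c', (a * c / (a * c + b * c')) • N + (b * c' / (a * c + b * c')) • N'),
      ⟨⟨h0.le, hle⟩, hS hN hN' (by positivity) (by positivity) (by field_simp)⟩, ?_⟩
    simp only [smul_add, smul_smul]
    congr 2 <;> field_simp

lemma aux_sep {d n : ℕ} (MF : Set (Fin n → Matrix (Fin d) (Fin d) ℂ))
    (hc : IsCompact MF) (hconv : Convex ℝ MF)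
    (hMF : ∀ N ∈ MF, ∀ i, (N i).PosSemidef)
    (M : Fin n → Matrix (Fin d) (Fin d) ℂ) (hM : ∀ i, (M i).PosSemidef) (g : ℝ)
    (hinf : ¬ ∃ c : ℝ, 0 ≤ c ∧ ∃ N ∈ MF, ∀ i,
        (c • N i - M i).PosSemidef ∧ (g • M i - c • N i).PosSemidef) :
    ∃ A B : Fin n → Matrix (Fin d) (Fin d) ℂ,
        (∀ i, (A i).PosSemidef ∧ (B i).PosSemidef) ∧
        ∀ c ∈ Set.Icc 0 g, ∀ N ∈ MF,
          c * (∑ i, ((A i * N i).trace).re - ∑ i, ((B i * N i).trace).re)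
          < ∑ i, ((A i * M i).trace).re - g * ∑ i, ((B i * M i).trace).re := by
  let V := Fin n → Matrix (Fin d) (Fin d) ℂ
  have : LocallyConvexSpace ℝ (Matrix (Fin d) (Fin d) ℂ) :=
    inferInstanceAs (LocallyConvexSpace ℝ (Fin d → Fin d → ℂ))
  let C : Set V := (fun p : ℝ × V => p.1 • p.2) '' (Set.Icc 0 g ×ˢ MF)
  have hC1 : Convex ℝ C := aux_cone_convex hconv g
  have hC2 : IsCompact C := (isCompact_Icc.prod hc).image (by fun_prop)
  let T : Set V := {X | ∀ i, (X i).PosSemidef}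
  have hT1 : Convex ℝ T := fun X hX Y hY a b ha hb _ i =>
    ((hX i).smul ha).add ((hY i).smul hb)
  have hT2 : IsClosed T := by
    simp only [T, Set.ofPred_forall]
    refine isClosed_iInter fun i => ?_
    have hcont : Continuous (fun X : V => X i) := continuous_apply i
    exact (aux_isClosed d).preimage hcont
  let K : Set (V × V) := (fun p : V × V => (-M, g • M) + p) '' ((fun x : V => (x, -x)) '' C)
  have hK1 : Convex ℝ K := by
    refine Convex.translate ?_ _
    exact hC1.is_linear_image (f := fun x : V => (x, -x))
      (LinearMap.prod LinearMap.id (-LinearMap.id)).isLinear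
  have hK2 : IsCompact K := (hC2.image (by fun_prop)).image (by fun_prop)
  have hmem : ∀ c ∈ Set.Icc 0 g, ∀ N ∈ MF, (-M, g • M) + (c • N, -(c • N)) ∈ K :=
    fun c hc N hN => ⟨_, ⟨_, ⟨(c, N), ⟨hc, hN⟩, rfl⟩, rfl⟩, rfl⟩
  have hdis : Disjoint K (T ×ˢ T) := by
    rw [Set.disjoint_left]
    rintro _ ⟨_, ⟨_, ⟨⟨c, N⟩, ⟨hc, hN⟩, rfl⟩, rfl⟩, rfl⟩ ⟨h1, h2⟩
    refine hinf ⟨c, hc.1, N, hN, fun i => ⟨?_, ?_⟩⟩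
    · have h3 : (-M i + c • N i).PosSemidef := h1 i
      rwa [sub_eq_neg_add]
    · have h3 : (g • M i + -(c • N i)).PosSemidef := h2 i
      rwa [sub_eq_add_neg]
  obtain ⟨f, u, v, hfK, huv, hfT⟩ := geometric_hahn_banach_compact_closed hK1 hK2
    (hT1.prod hT1) (hT2.prod hT2) hdis
  have hT0 : (0 : V) ∈ T := fun i => Matrix.PosSemidef.zero
  have hv : v < 0 := by simpa using hfT 0 ⟨hT0, hT0⟩
  have hpos : ∀ p ∈ T ×ˢ T, 0 ≤ f p := by
    intro p hp
    by_contra! hneg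
    have hs : 0 ≤ v / f p := (div_pos_of_neg_of_neg hv hneg).le
    have := hfT ((v / f p) • p) ⟨fun i => (hp.1 i).smul hs, fun i => (hp.2 i).smul hs⟩
    rw [map_smul, smul_eq_mul, div_mul_cancel₀ _ hneg.ne] at this
    exact lt_irrefl _ this
  obtain ⟨A, hA, hA'⟩ := aux_repr_pi (f.toLinearMap ∘ₗ LinearMap.inl ℝ V V)
    (fun X hX => hpos (X, 0) ⟨hX, hT0⟩)
  obtain ⟨B, hB, hB'⟩ := aux_repr_pi (f.toLinearMap ∘ₗ LinearMap.inr ℝ V V)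
    (fun X hX => hpos (0, X) ⟨hT0, hX⟩)
  refine ⟨A, B, fun i => ⟨hA i, hB i⟩, fun c hc N hN => ?_⟩
  have h := hfK _ (hmem c hc N hN)
  rw [← hA' N (fun i => (hMF N hN i).isHermitian), ← hB' N (fun i => (hMF N hN i).isHermitian),
    ← hA' M (fun i => (hM i).isHermitian), ← hB' M (fun i => (hM i).isHermitian)]
  have e : ((-M, g • M) + (c • N, -(c • N)) : V × V) =
      -(LinearMap.inl ℝ V V M) + g • (LinearMap.inr ℝ V V M) + c • (LinearMap.inl ℝ V V N)
        - c • (LinearMap.inr ℝ V V N) := by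
    ext1 <;> simp [sub_eq_add_neg]
  rw [e] at h
  simp only [map_add, map_sub, map_neg, map_smul, smul_eq_mul] at h
  simp only [LinearMap.comp_apply, ContinuousLinearMap.coe_coe]
  linarith

lemma aux_trace_povm {d n : ℕ} {N : Fin n → Matrix (Fin d) (Fin d) ℂ} (hN : IsPOVM N) :
    ∑ i, ((N i).trace).re = d := by
  rw [← Complex.re_sum, ← Matrix.trace_sum, hN.2]
  simp

lemma aux_tr_le {d n : ℕ} {A X Y : Fin n → Matrix (Fin d) (Fin d) ℂ}
    (hA : ∀ i, (A i).PosSemidef) (h : ∀ i, (Y i - X i).PosSemidef) :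
    ∑ i, ((A i * X i).trace).re ≤ ∑ i, ((A i * Y i).trace).re := by
  refine Finset.sum_le_sum fun i _ => ?_
  have := aux_trace_nonneg (hA i) (h i)
  rw [Matrix.mul_sub, Matrix.trace_sub, Complex.sub_re] at this
  linarith

lemma aux_tr_smul {d n : ℕ} (A X : Fin n → Matrix (Fin d) (Fin d) ℂ) (c : ℝ) :
    ∑ i, ((A i * (c • X i)).trace).re = c * ∑ i, ((A i * X i).trace).re := by
  rw [Finset.mul_sum]
  refine Finset.sum_congr rfl fun i _ => ?_
  rw [Matrix.mul_smul, Matrix.trace_smul, Complex.smul_re, smul_eq_mul]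

lemma aux_smul_tr {d n : ℕ} (A X : Fin n → Matrix (Fin d) (Fin d) ℂ) (c : ℝ) :
    ∑ i, (((c • A i) * X i).trace).re = c * ∑ i, ((A i * X i).trace).re := by
  rw [Finset.mul_sum]
  refine Finset.sum_congr rfl fun i _ => ?_
  rw [Matrix.smul_mul, Matrix.trace_smul, Complex.smul_re, smul_eq_mul]

lemma aux_dual {d n : ℕ} (hd : 0 < d) (MF : Set (Fin n → Matrix (Fin d) (Fin d) ℂ))
    (hne : MF.Nonempty) (hc : IsCompact MF) (hconv : Convex ℝ MF)
    (hMF : ∀ N ∈ MF, IsPOVM N)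
    (M : Fin n → Matrix (Fin d) (Fin d) ℂ) (hM : IsPOVM M) (g : ℝ) (hg : 0 < g)
    (hinf : ¬ ∃ c : ℝ, 0 ≤ c ∧ ∃ N ∈ MF, ∀ i,
        (c • N i - M i).PosSemidef ∧ (g • M i - c • N i).PosSemidef) :
    ∃ A B : Fin n → Matrix (Fin d) (Fin d) ℂ,
        (∀ i, (A i).PosSemidef ∧ (B i).PosSemidef) ∧
        (∑ i, ((B i * M i).trace).re) = 1 ∧
        (∀ N ∈ MF, (∑ i, ((A i * N i).trace).re) ≤ (∑ i, ((B i * N i).trace).re)) ∧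
        g = ∑ i, ((A i * M i).trace).re := by
  obtain ⟨A, B, hAB, h⟩ := aux_sep MF hc hconv (fun N hN => (hMF N hN).1) M hM.1 g hinf
  obtain ⟨N₀, hN₀⟩ := hne
  have h0 := h 0 ⟨le_rfl, hg.le⟩ N₀ hN₀
  rw [zero_mul] at h0
  have hb : 0 ≤ ∑ i, ((B i * M i).trace).re :=
    Finset.sum_nonneg fun i _ => aux_trace_nonneg (hAB i).2 (hM.1 i)
  set a := ∑ i, ((A i * M i).trace).re with ha
  set b := ∑ i, ((B i * M i).trace).re with hb'
  have hd' : (0 : ℝ) < d := by exact_mod_cast hd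
  have hap : 0 < a := by nlinarith
  set t := (a - g * b) / g with ht
  have htp : 0 < t := div_pos h0 hg
  have hgt : g * t = a - g * b := by rw [ht]; field_simp
  let B' : Fin n → Matrix (Fin d) (Fin d) ℂ := fun i => B i + (t / d) • (1 : Matrix (Fin d) (Fin d) ℂ)
  have hB'p : ∀ i, (B' i).PosSemidef := fun i =>
    (hAB i).2.add (Matrix.PosSemidef.one.smul (by positivity))
  have hB' : ∀ N, IsPOVM N → ∑ i, ((B' i * N i).trace).re = ∑ i, ((B i * N i).trace).re + t := by
    intro N hN
    have e : ∀ i, ((B' i * N i).trace).re = ((B i * N i).trace).re + (t / d) * ((N i).trace).re := by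
      intro i
      simp only [B', Matrix.add_mul, Matrix.smul_mul, Matrix.one_mul, Matrix.trace_add,
        Matrix.trace_smul, Complex.add_re, Complex.smul_re, smul_eq_mul]
    simp only [e, Finset.sum_add_distrib]
    rw [← Finset.mul_sum, aux_trace_povm hN]
    field_simp
  have hs : 0 ≤ g / a := by positivity
  refine ⟨fun i => (g / a) • A i, fun i => (g / a) • B' i,
    fun i => ⟨(hAB i).1.smul hs, (hB'p i).smul hs⟩, ?_, ?_, ?_⟩
  · rw [aux_smul_tr, hB' M hM, ← hb']
    have : a = g * (b + t) := by linarith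
    rw [div_mul_eq_mul_div, ← this, div_self hap.ne']
  · intro N hN
    rw [aux_smul_tr, aux_smul_tr, hB' N (hMF N hN)]
    refine mul_le_mul_of_nonneg_left ?_ hs
    have h1 := h g ⟨hg.le, le_rfl⟩ N hN
    rw [← hgt] at h1
    linarith [lt_of_mul_lt_mul_left h1 hg.le]
  · rw [aux_smul_tr, ← ha]
    field_simp

/-- Theorem 6(v): primal conic form and strong duality for the projective robustness
of measurements, for a nonempty compact convex free set. -/
theorem projective_robustness_measurement_conic_duality
    (d n : ℕ) (hd : 0 < d) (hn : 0 < n)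
    (MF : Set (Fin n → Matrix (Fin d) (Fin d) ℂ))
    (hne : MF.Nonempty) (hc : IsCompact MF) (hconv : Convex ℝ MF)
    (hMF : ∀ N ∈ MF, IsPOVM N)
    (M : Fin n → Matrix (Fin d) (Fin d) ℂ) (hM : IsPOVM M) :
    OmegaM MF M = sInf {γ : ENNReal | ∃ g : ℝ, 0 ≤ g ∧
      (∃ c : ℝ, 0 ≤ c ∧ ∃ N ∈ MF, ∀ i,
        (c • N i - M i).PosSemidef ∧ (g • M i - c • N i).PosSemidef) ∧
      γ = ENNReal.ofReal g}
    ∧ OmegaM MF M = sSup {γ : ENNReal |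
      ∃ A B : Fin n → Matrix (Fin d) (Fin d) ℂ,
        (∀ i, (A i).PosSemidef ∧ (B i).PosSemidef) ∧
        (∑ i, ((B i * M i).trace).re) = 1 ∧
        (∀ N ∈ MF, (∑ i, ((A i * N i).trace).re) ≤ (∑ i, ((B i * N i).trace).re)) ∧
        γ = ENNReal.ofReal (∑ i, ((A i * M i).trace).re)} := by
  have hd' : (0 : ℝ) < d := by exact_mod_cast hd
  have part1 : OmegaM MF M = sInf {γ : ENNReal | ∃ g : ℝ, 0 ≤ g ∧
      (∃ c : ℝ, 0 ≤ c ∧ ∃ N ∈ MF, ∀ i,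
        (c • N i - M i).PosSemidef ∧ (g • M i - c • N i).PosSemidef) ∧
      γ = ENNReal.ofReal g} := by
    unfold OmegaM
    congr 1
    ext γ
    constructor
    · rintro ⟨l, m, hl, hm, ⟨N, hN, h⟩, rfl⟩
      refine ⟨l * m, mul_nonneg hl hm, ⟨l, hl, N, hN, fun i => ⟨(h i).1, ?_⟩⟩, rfl⟩
      have := (h i).2.smul hl
      rwa [smul_sub, smul_smul] at this
    · rintro ⟨g, hg, ⟨c, hc0, N, hN, h⟩, rfl⟩
      have hcp : 0 < c := by
        have h1 := aux_tr_le (A := fun _ => 1) (fun _ => Matrix.PosSemidef.one) (fun i => (h i).1)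
        rw [aux_tr_smul] at h1
        simp only [Matrix.one_mul] at h1
        rw [aux_trace_povm hM, aux_trace_povm (hMF N hN)] at h1
        nlinarith
      refine ⟨c, g / c, hc0, by positivity, ⟨N, hN, fun i => ⟨(h i).1, ?_⟩⟩, ?_⟩
      · have := (h i).2.smul (inv_nonneg.2 hc0)
        rw [smul_sub, smul_smul, smul_smul, inv_mul_cancel₀ hcp.ne', one_smul] at this
        rwa [div_eq_inv_mul]
      · rw [mul_div_cancel₀ _ hcp.ne']
  refine ⟨part1, ?_⟩
  rw [part1]
  apply le_antisymm
  · refine le_of_forall_lt fun x hx => ?_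
    obtain ⟨y, hxy, hy⟩ := exists_between hx
    refine lt_of_lt_of_le hxy ?_
    have hyt : y ≠ ⊤ := ne_top_of_lt hy
    have hy0 : 0 < y.toReal := ENNReal.toReal_pos (ne_bot_of_gt hxy) hyt
    have hninf : ¬ ∃ c : ℝ, 0 ≤ c ∧ ∃ N ∈ MF, ∀ i,
        (c • N i - M i).PosSemidef ∧ (y.toReal • M i - c • N i).PosSemidef := by
      intro hfeas
      refine absurd hy (not_lt.2 (sInf_le ?_))
      exact ⟨y.toReal, hy0.le, hfeas, (ENNReal.ofReal_toReal hyt).symm⟩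
    obtain ⟨A, B, h1, h2, h3, h4⟩ := aux_dual hd MF hne hc hconv hMF M hM _ hy0 hninf
    exact le_sSup ⟨A, B, h1, h2, h3, by rw [← h4, ENNReal.ofReal_toReal hyt]⟩
  · refine sSup_le ?_
    rintro _ ⟨A, B, hAB, hB1, hle, rfl⟩
    refine le_sInf ?_
    rintro _ ⟨g, hg, ⟨c, hc0, N, hN, h⟩, rfl⟩
    refine ENNReal.ofReal_le_ofReal ?_
    have h1 := aux_tr_le (fun i => (hAB i).1) (fun i => (h i).1)
    have h2 := aux_tr_le (fun i => (hAB i).2) (fun i => (h i).2)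
    rw [aux_tr_smul] at h1
    rw [aux_tr_smul, aux_tr_smul, hB1] at h2
    have h3 := mul_le_mul_of_nonneg_left (hle N hN) hc0
    linarith
end

section
/- Fix positive integers d and n, let ℳF be a set of POVMs with n outcomes on ℂ^d, and let M be a POVM. Define R_{ℳF}(M) := inf {λ ∈ [0,∞) : ∃ N ∈ ℳF, ∀ i, M i ≤ λ • (N i)}, W_{ℳF}(M)⁻¹ := inf {μ ∈ [0,∞) : ∃ N ∈ ℳF, ∀ i, N i ≤ μ • (M i)}, and for POVMs M, N set R_max(M‖N) := inf {λ ∈ [0,∞) : ∀ i, M i ≤ λ • (N i)} (all in [0,∞]). Then: (a) R_{ℳF}(M) · W_{ℳF}(M)⁻¹ ≤ Ω_{ℳF}(M); (b) if N_R ∈ ℳF satisfies R_{ℳF}(M) = R_max(M‖N_R), then Ω_{ℳF}(M) ≤ R_{ℳF}(M) · R_max(N_R‖M); (c) if N_W ∈ ℳF satisfies W_{ℳF}(M)⁻¹ = R_max(N_W‖M), then Ω_{ℳF}(M) ≤ W_{ℳF}(M)⁻¹ · R_max(M‖N_W). (Theorem 6(vi).) -/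
open Matrix ComplexOrder

/-- R_max for tuples of effects: inf {λ ∈ [0,∞) : ∀ i, M i ≤ λ • N i}. -/
noncomputable def RmaxM {d n : ℕ}
    (M N : Fin n → Matrix (Fin d) (Fin d) ℂ) : ENNReal :=
  sInf {γ : ENNReal | ∃ lam : ℝ, 0 ≤ lam ∧
    (∀ i, (lam • N i - M i).PosSemidef) ∧ γ = ENNReal.ofReal lam}

/-- Generalized robustness of measurements. -/
noncomputable def genRobM {d n : ℕ}
    (MF : Set (Fin n → Matrix (Fin d) (Fin d) ℂ))
    (M : Fin n → Matrix (Fin d) (Fin d) ℂ) : ENNReal :=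
  sInf {γ : ENNReal | ∃ lam : ℝ, 0 ≤ lam ∧
    (∃ N ∈ MF, ∀ i, (lam • N i - M i).PosSemidef) ∧ γ = ENNReal.ofReal lam}

/-- Inverse weight of measurements. -/
noncomputable def invWeightM {d n : ℕ}
    (MF : Set (Fin n → Matrix (Fin d) (Fin d) ℂ))
    (M : Fin n → Matrix (Fin d) (Fin d) ℂ) : ENNReal :=
  sInf {γ : ENNReal | ∃ mu : ℝ, 0 ≤ mu ∧
    (∃ N ∈ MF, ∀ i, (mu • M i - N i).PosSemidef) ∧ γ = ENNReal.ofReal mu}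

theorem ennreal_le_sInf_mul_sInf (A B : Set ENNReal) (c : ENNReal)
    (hA : sInf A ≠ 0) (hB : sInf B ≠ 0)
    (h : ∀ a ∈ A, ∀ b ∈ B, c ≤ a * b) : c ≤ sInf A * sInf B := by
  by_cases hBt : sInf B = ⊤
  · rw [hBt, ENNReal.mul_top hA]; exact le_top
  rw [← ENNReal.div_le_iff hB hBt]
  refine le_sInf fun a ha => ?_
  rw [ENNReal.div_le_iff hB hBt]
  have ha0 : a ≠ 0 := fun h0 => hA (le_antisymm (h0 ▸ sInf_le ha) bot_le)
  by_cases hat : a = ⊤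
  · rw [hat, ENNReal.top_mul hB]; exact le_top
  rw [mul_comm, ← ENNReal.div_le_iff ha0 hat]
  refine le_sInf fun b hb => ?_
  rw [ENNReal.div_le_iff ha0 hat, mul_comm]
  exact h a ha b hb

theorem RmaxM_ne_zero {d n : ℕ} (hd : 0 < d)
    (M N : Fin n → Matrix (Fin d) (Fin d) ℂ) (hM : IsPOVM M) (hN : IsPOVM N) :
    RmaxM M N ≠ 0 := by
  have h1 : (1 : ENNReal) ≤ RmaxM M N := by
    refine le_sInf ?_
    rintro γ ⟨lam, h0, h, rfl⟩
    rw [ENNReal.one_le_ofReal]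
    have hs : (∑ i, (lam • N i - M i)).PosSemidef :=
      Matrix.posSemidef_sum _ fun i _ => h i
    rw [Finset.sum_sub_distrib, ← Finset.smul_sum, hM.2, hN.2] at hs
    have hdg := hs.diag_nonneg (i := ⟨0, hd⟩)
    simp at hdg
    have := (Complex.le_def.1 hdg).1
    simpa using this
  intro h
  rw [h] at h1
  simp at h1

theorem OmegaM_le_mul {d n : ℕ} (hd : 0 < d)
    (MF : Set (Fin n → Matrix (Fin d) (Fin d) ℂ))
    (M N : Fin n → Matrix (Fin d) (Fin d) ℂ) (hM : IsPOVM M) (hN : IsPOVM N) (hmem : N ∈ MF) :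
    OmegaM MF M ≤ RmaxM M N * RmaxM N M := by
  refine ennreal_le_sInf_mul_sInf _ _ _ (RmaxM_ne_zero hd M N hM hN)
    (RmaxM_ne_zero hd N M hN hM) ?_
  rintro _ ⟨lam, hl, h1, rfl⟩ _ ⟨mu, hm, h2, rfl⟩
  rw [← ENNReal.ofReal_mul hl]
  exact sInf_le ⟨lam, mu, hl, hm, ⟨N, hmem, fun i => ⟨h1 i, h2 i⟩⟩, rfl⟩

/-- Theorem 6(vi): bounds on the projective robustness of measurements in terms of
the generalized robustness and the weight. -/
theorem projective_robustness_measurement_bounds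
    (d n : ℕ) (hd : 0 < d) (hn : 0 < n)
    (MF : Set (Fin n → Matrix (Fin d) (Fin d) ℂ)) (hMF : ∀ N ∈ MF, IsPOVM N)
    (M : Fin n → Matrix (Fin d) (Fin d) ℂ) (hM : IsPOVM M) :
    genRobM MF M * invWeightM MF M ≤ OmegaM MF M
    ∧ (∀ N_R ∈ MF, genRobM MF M = RmaxM M N_R →
        OmegaM MF M ≤ genRobM MF M * RmaxM N_R M)
    ∧ (∀ N_W ∈ MF, invWeightM MF M = RmaxM N_W M →
        OmegaM MF M ≤ invWeightM MF M * RmaxM M N_W) := by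
  refine ⟨?_, ?_, ?_⟩
  · refine le_sInf ?_
    rintro _ ⟨lam, mu, hl, hm, ⟨N, hN, h⟩, rfl⟩
    rw [ENNReal.ofReal_mul hl]
    exact mul_le_mul' (sInf_le ⟨lam, hl, ⟨N, hN, fun i => (h i).1⟩, rfl⟩)
      (sInf_le ⟨mu, hm, ⟨N, hN, fun i => (h i).2⟩, rfl⟩)
  · intro N hN h
    rw [h]
    exact OmegaM_le_mul hd MF M N hM (hMF N hN) hN
  · intro N hN h
    rw [h, mul_comm]
    exact OmegaM_le_mul hd MF M N hM (hMF N hN) hN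
end

section
/- Let X (measurement settings) and A (outcomes) be nonempty finite types and d ≥ 1. A measurement assemblage is a family M : X → A → Matrix (Fin d) (Fin d) ℂ with every M x a positive semidefinite and ∑_a M x a = 1 for every x. M is compatible if there exist a finite type ι, a POVM N : ι → Matrix (Fin d) (Fin d) ℂ (each N i PSD, ∑_i N i = 1), and conditional probabilities q : ι → X → A → ℝ with q i x a ≥ 0 and ∑_a q i x a = 1 for all i, x, such that M x a = ∑_i q i x a • N i for all x, a. Define Ω_𝔠(M) := inf {λ·μ : λ, μ ∈ [0,∞), ∃ compatible assemblage G, ∀ x a, M x a ≤ λ • (G x a) and G x a ≤ μ • (M x a)} ∈ [0,∞]. For an assemblage M, let J_M be the matrix indexed by (X × Fin d) × A with entries J_M(((x,i),a), ((x',i'),a')) = (if x = x' ∧ a = a' then (M x a) i' i else 0) (the Choi matrix of the channel σ⊗ρ ↦ ∑_{x,a} ⟨x|σ|x⟩ Tr(M x a · ρ) |a⟩⟨a|), and let F := {J_G : G a compatible assemblage}. Then Ω_F(J_M) = Ω_𝔠(M), i.e. the projective robustness of the channel associated with M relative to the free channels representing compatible POVM families equals the projective robustness of measurement incompatibility of M.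 (Proposition 2.) -/
open Matrix ComplexOrder

/-- A measurement assemblage: a family of POVMs indexed by settings `X`. -/
def IsAssemblage {X A : Type*} [Fintype A] {d : ℕ}
    (M : X → A → Matrix (Fin d) (Fin d) ℂ) : Prop :=
  (∀ x a, (M x a).PosSemidef) ∧ ∀ x, (∑ a, M x a) = 1

/-- Compatibility (joint measurability) of a measurement assemblage: there are a
parent POVM `N` and conditional probabilities `q` with `M x a = ∑ i, q i x a • N i`. -/
def IsCompatible {X A : Type*} [Fintype X] [Fintype A] {d : ℕ}
    (M : X → A → Matrix (Fin d) (Fin d) ℂ) : Prop :=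
  ∃ (m : ℕ) (N : Fin m → Matrix (Fin d) (Fin d) ℂ) (q : Fin m → X → A → ℝ),
    (∀ i, (N i).PosSemidef) ∧ ((∑ i, N i) = 1) ∧
    (∀ i x a, 0 ≤ q i x a) ∧ (∀ i x, (∑ a, q i x a) = 1) ∧
    (∀ x a, M x a = ∑ i, q i x a • N i)

/-- The projective robustness of measurement incompatibility. -/
noncomputable def OmegaC {X A : Type*} [Fintype X] [Fintype A] {d : ℕ}
    (M : X → A → Matrix (Fin d) (Fin d) ℂ) : ENNReal :=
  sInf {γ : ENNReal | ∃ lam mu : ℝ, 0 ≤ lam ∧ 0 ≤ mu ∧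
    (∃ G : X → A → Matrix (Fin d) (Fin d) ℂ, IsCompatible G ∧
      ∀ x a, (lam • G x a - M x a).PosSemidef ∧ (mu • M x a - G x a).PosSemidef) ∧
    γ = ENNReal.ofReal (lam * mu)}

/-- The Choi matrix of the measure-and-prepare channel
`σ ⊗ ρ ↦ ∑_{x,a} ⟨x|σ|x⟩ Tr(M x a · ρ) |a⟩⟨a|` associated with an assemblage `M`. -/
def ChoiOf {X A : Type*} [DecidableEq X] [DecidableEq A] {d : ℕ}
    (M : X → A → Matrix (Fin d) (Fin d) ℂ) :
    Matrix ((X × Fin d) × A) ((X × Fin d) × A) ℂ :=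
  fun p q => if p.1.1 = q.1.1 ∧ p.2 = q.2 then M p.1.1 p.2 q.1.2 p.1.2 else 0

theorem choi_psd_iff {X A : Type*} [Fintype X] [Fintype A] [DecidableEq X] [DecidableEq A]
    {d : ℕ} (G : X → A → Matrix (Fin d) (Fin d) ℂ) :
    (ChoiOf G).PosSemidef ↔ ∀ x a, (G x a).PosSemidef := by
  constructor
  · intro h x a
    have h1 := (h.submatrix (fun i : Fin d => ((x, i), a))).transpose
    have h2 : ((ChoiOf G).submatrix (fun i : Fin d => ((x, i), a))
        (fun i : Fin d => ((x, i), a)))ᵀ = G x a := by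
      ext i j
      simp [ChoiOf]
    rwa [h2] at h1
  · intro h
    have key : ChoiOf G = ∑ y : X × A,
        (diagonal (fun p : (X × Fin d) × A => if (p.1.1, p.2) = y then (1 : ℂ) else 0)) *
          ((G y.1 y.2)ᵀ.submatrix (fun p : (X × Fin d) × A => p.1.2) (fun p => p.1.2)) *
        (diagonal (fun p : (X × Fin d) × A => if (p.1.1, p.2) = y then (1 : ℂ) else 0))ᴴ := by
      ext p q
      rw [Matrix.sum_apply, Finset.sum_eq_single (p.1.1, p.2)]
      · simp only [diagonal_conjTranspose, mul_diagonal, diagonal_mul, ChoiOf]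
        by_cases hpq : p.1.1 = q.1.1 ∧ p.2 = q.2
        · simp [hpq]
        · have h' : ¬ (q.1.1 = p.1.1 ∧ q.2 = p.2) := fun h => hpq ⟨h.1.symm, h.2.symm⟩
          simp [hpq, h']
      · intro b _ hb
        simp [diagonal_conjTranspose, mul_diagonal, diagonal_mul, hb.symm]
      · simp
    rw [key]
    refine posSemidef_sum _ fun y _ => ?_
    exact ((h y.1 y.2).transpose.submatrix _).mul_mul_conjTranspose_same _

theorem choi_smul_sub {X A : Type*} [DecidableEq X] [DecidableEq A]
    {d : ℕ} (c : ℝ) (G M : X → A → Matrix (Fin d) (Fin d) ℂ) :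
    c • ChoiOf G - ChoiOf M = ChoiOf (fun x a => c • G x a - M x a) := by
  ext p q
  simp only [ChoiOf, Matrix.sub_apply, Matrix.smul_apply]
  split_ifs <;> simp

/-- Proposition 2: the projective robustness of the channel associated with an
assemblage `M`, relative to the free channels representing compatible POVM families,
equals the projective robustness of measurement incompatibility of `M`. -/
theorem projective_robustness_incompatibility
    (X A : Type*) [Fintype X] [Fintype A] [DecidableEq X] [DecidableEq A]
    [Nonempty X] [Nonempty A] (d : ℕ) (hd : 1 ≤ d)
    (M : X → A → Matrix (Fin d) (Fin d) ℂ) (hM : IsAssemblage M) :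
    Omega {J | ∃ G : X → A → Matrix (Fin d) (Fin d) ℂ,
        IsCompatible G ∧ J = ChoiOf G} (ChoiOf M) = OmegaC M := by
  unfold Omega OmegaC
  congr 1
  ext γ
  constructor
  · rintro ⟨l, m, hl, hm, ⟨K, ⟨G, hG, rfl⟩, h1, h2⟩, rfl⟩
    rw [choi_smul_sub, choi_psd_iff] at h1 h2
    exact ⟨l, m, hl, hm, ⟨G, hG, fun x a => ⟨h1 x a, h2 x a⟩⟩, rfl⟩
  · rintro ⟨l, m, hl, hm, ⟨G, hG, h⟩, rfl⟩
    refine ⟨l, m, hl, hm, ⟨_, ⟨G, hG, rfl⟩, ?_, ?_⟩, rfl⟩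
    · rw [choi_smul_sub, choi_psd_iff]
      exact fun x a => (h x a).1
    · rw [choi_smul_sub, choi_psd_iff]
      exact fun x a => (h x a).2
end
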